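/- The Gaussian mechanism M(D) = f(D) + N(0, Δ_f²σ²I) applied to a function f with L2-sensitivity Δ_f satisfies (ε, δ)-differential privacy for any ε ∈ (0,1) provided σ ≥ √(2 ln(1.25/δ))/ε. -/

import Mathlib

open MeasureTheory ProbabilityTheory Real

/-- `(ε, δ)`-differential privacy of a mechanism `M` with respect to an adjacency relation. -/
def IsDP {X Ω : Type*} [MeasurableSpace Ω] (M : X → Measure Ω) (adj : X → X → Prop)
    (ε δ : ℝ) : Prop :=
  ∀ D D', adj D D' → ∀ R : Set Ω, MeasurableSet R →
    M D R ≤ ENNReal.ofReal (Real.exp ε) * M D' R + ENNReal.ofReal δ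

open scoped NNReal ENNReal

/-- A Gaussian measure with mean `m` as an exponential tilt of the centered one. -/
lemma gaussianReal_eq_withDensity_gaussianReal_zero (m : ℝ) {v : ℝ≥0} (hv : v ≠ 0) :
    gaussianReal m v = (gaussianReal 0 v).withDensity
      (fun x => ENNReal.ofReal (Real.exp ((m * x - m ^ 2 / 2) / v))) := by
  have hv' : (v : ℝ) ≠ 0 := by exact_mod_cast hv
  rw [gaussianReal_of_var_ne_zero _ hv, gaussianReal_of_var_ne_zero _ hv,
    ← withDensity_mul _ (measurable_gaussianPDF 0 v) (by fun_prop)]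
  congr 1
  ext x
  simp only [Pi.mul_apply, gaussianPDF]
  rw [← ENNReal.ofReal_mul (gaussianPDFReal_nonneg 0 v x)]
  congr 1
  simp only [gaussianPDFReal]
  rw [mul_assoc (√(2 * π * v))⁻¹, ← Real.exp_add]
  congr 2
  field_simp
  ring

/-- A product of Gaussian measures with means `m i` as an exponential tilt of the centered one. -/
lemma pi_gaussianReal_eq_withDensity {ι : Type*} [Fintype ι] (m : ι → ℝ) {v : ℝ≥0}
    (hv : v ≠ 0) :
    Measure.pi (fun i => gaussianReal (m i) v) =
      (Measure.pi fun _ : ι => gaussianReal 0 v).withDensity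
        (fun x => ENNReal.ofReal (Real.exp ((∑ i, (m i * x i - m i ^ 2 / 2)) / v))) := by
  refine Measure.pi_eq fun s hs => ?_
  rw [withDensity_apply _ (.univ_pi hs), ← lintegral_indicator (.univ_pi hs)]
  set g : ι → ℝ → ℝ≥0∞ := fun i => (s i).indicator
    (fun y => ENNReal.ofReal (Real.exp ((m i * y - m i ^ 2 / 2) / v))) with hg
  have hgm : ∀ i, Measurable (g i) := fun i => Measurable.indicator (by fun_prop) (hs i)
  have hprod : ∀ x : ι → ℝ, (Set.univ.pi s).indicator (fun x : ι → ℝ =>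
      ENNReal.ofReal (Real.exp ((∑ i, (m i * x i - m i ^ 2 / 2)) / v))) x = ∏ i, g i (x i) := by
    intro x
    by_cases hx : x ∈ Set.univ.pi s
    · rw [Set.indicator_of_mem hx, Finset.sum_div, Real.exp_sum,
        ENNReal.ofReal_prod_of_nonneg fun i _ => (Real.exp_pos _).le]
      refine Finset.prod_congr rfl fun i _ => ?_
      simp only [hg]
      rw [Set.indicator_of_mem (hx i (Set.mem_univ i))]
    · rw [Set.indicator_of_notMem hx]
      simp only [Set.mem_pi, Set.mem_univ, true_imp_iff, not_forall] at hx
      obtain ⟨i, hi⟩ := hx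
      refine (Finset.prod_eq_zero (Finset.mem_univ i) ?_).symm
      simp only [hg]
      rw [Set.indicator_of_notMem hi]
  simp_rw [hprod]
  rw [lintegral_prod_eq_prod_lintegral_of_indepFun Finset.univ (fun i (x : ι → ℝ) => g i (x i))
    (iIndepFun_pi fun i => (hgm i).aemeasurable) fun i => (hgm i).comp (measurable_pi_apply i)]
  refine Finset.prod_congr rfl fun i _ => ?_
  rw [(measurePreserving_eval (fun _ : ι => gaussianReal 0 v) i).lintegral_comp (hgm i)]
  rw [lintegral_indicator (hs i), gaussianReal_eq_withDensity_gaussianReal_zero (m i) hv,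
    withDensity_apply _ (hs i)]

lemma pi_gaussianReal_map_add {ι : Type*} [Fintype ι] (m : ι → ℝ) (v : ℝ≥0) :
    (Measure.pi fun _ : ι => gaussianReal 0 v).map (fun x => x + m) =
      Measure.pi (fun i => gaussianReal (m i) v) := by
  have h (i : ι) : (gaussianReal 0 v).map (fun y => y + m i) = gaussianReal (m i) v := by
    rw [gaussianReal_map_add_const, zero_add]
  have (i : ι) : SigmaFinite ((gaussianReal 0 v).map (fun y => y + m i)) := by
    rw [h]; infer_instance
  simp_rw [← h]
  exact Measure.pi_map_pi (f := fun i y => y + m i) fun i => by fun_prop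

/-- A linear functional of independent centered Gaussian variables is Gaussian. -/
lemma pi_gaussianReal_map_sum_mul {ι : Type*} [Fintype ι] (a : ι → ℝ) (v r : ℝ≥0)
    (hr : (r : ℝ) = v * ∑ i, a i ^ 2) :
    (Measure.pi fun _ : ι => gaussianReal 0 v).map (fun x => ∑ i, a i * x i) =
      gaussianReal 0 r := by
  have hm : Measurable fun x : ι → ℝ => ∑ i, a i * x i := by fun_prop
  have : IsProbabilityMeasure ((Measure.pi fun _ : ι => gaussianReal 0 v).map
    (fun x => ∑ i, a i * x i)) := Measure.isProbabilityMeasure_map hm.aemeasurable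
  refine Measure.ext_of_charFun ?_
  ext t
  have h := charFun_pi (μ := fun _ : ι => gaussianReal 0 v) (WithLp.toLp 2 (t • a))
  rw [charFun_apply, integral_map (by fun_prop) (by fun_prop)] at h
  rw [charFun_apply_real, integral_map hm.aemeasurable (by fun_prop)]
  have e : ∀ x : ι → ℝ, (t : ℂ) * ((∑ i, a i * x i : ℝ) : ℂ) =
      ((inner ℝ (WithLp.toLp 2 x) (WithLp.toLp 2 (t • a)) : ℝ) : ℂ) := by
    intro x
    simp only [PiLp.inner_apply, RCLike.inner_apply, conj_trivial, Pi.smul_apply, smul_eq_mul]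
    push_cast
    rw [Finset.mul_sum]
    exact Finset.sum_congr rfl fun i _ => by ring
  simp_rw [e]
  rw [h]
  simp_rw [charFun_gaussianReal]
  rw [← Complex.exp_sum]
  congr 1
  have hrC : (r : ℂ) = v * ∑ i, (a i : ℂ) ^ 2 := by 
    exact_mod_cast congrArg (fun z : ℝ => (z : ℂ)) hr
  rw [show ((r : ℝ) : ℂ) = v * ∑ i, (a i : ℂ) ^ 2 from hrC]
  simp only [Pi.smul_apply, smul_eq_mul]
  push_cast
  simp only [mul_zero, zero_mul, zero_sub]
  rw [Finset.mul_sum, Finset.sum_mul, Finset.sum_div, ← Finset.sum_neg_distrib]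
  exact Finset.sum_congr rfl fun i _ => by ring

lemma gaussianReal_Ioi_zero_le (v : ℝ≥0) :
    gaussianReal 0 v (Set.Ioi 0) ≤ ENNReal.ofReal (1 / 2) := by
  have hsymm : gaussianReal 0 v (Set.Iio 0) = gaussianReal 0 v (Set.Ioi 0) := by
    have h := gaussianReal_map_neg (μ := 0) (v := v)
    rw [neg_zero] at h
    conv_rhs => rw [← h]
    rw [Measure.map_apply (by fun_prop) measurableSet_Ioi]
    congr 1
    ext x
    simp
  have hd : Disjoint (Set.Iio (0 : ℝ)) (Set.Ioi 0) :=
    Set.disjoint_left.2 fun x (hx : x < 0) (hx' : 0 < x) => lt_asymm hx hx'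
  have h1 : gaussianReal 0 v (Set.Ioi 0) + gaussianReal 0 v (Set.Ioi 0) ≤ 1 := by
    nth_rewrite 1 [← hsymm]
    rw [← measure_union hd measurableSet_Ioi]
    exact prob_le_one
  have hfin : gaussianReal 0 v (Set.Ioi 0) ≠ ∞ := measure_ne_top _ _
  rw [ENNReal.le_ofReal_iff_toReal_le hfin (by norm_num)]
  have h2 := ENNReal.toReal_mono ENNReal.one_ne_top h1
  rw [ENNReal.toReal_add hfin hfin, ENNReal.toReal_one] at h2
  linarith

lemma gaussianReal_Ioi_le_of_nonneg {t : ℝ} (ht : 0 ≤ t) :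
    gaussianReal 0 1 (Set.Ioi t) ≤ ENNReal.ofReal (Real.exp (-t ^ 2 / 2) / 2) := by
  have h : gaussianReal 0 1 (Set.Ioi t) = gaussianReal (-t) 1 (Set.Ioi 0) := by
    have h' := gaussianReal_map_add_const (μ := 0) (v := 1) (-t)
    rw [zero_add] at h'
    rw [← h', Measure.map_apply (by fun_prop) measurableSet_Ioi]
    congr 1
    ext x
    simp
  rw [h, gaussianReal_eq_withDensity_gaussianReal_zero _ one_ne_zero,
    withDensity_apply _ measurableSet_Ioi]
  calc ∫⁻ x in Set.Ioi 0, ENNReal.ofReal (Real.exp ((-t * x - (-t) ^ 2 / 2) / (1 : ℝ≥0)))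
        ∂gaussianReal 0 1
      ≤ ∫⁻ _ in Set.Ioi 0, ENNReal.ofReal (Real.exp (-t ^ 2 / 2)) ∂gaussianReal 0 1 := by
        refine setLIntegral_mono measurable_const fun x hx => ?_
        refine ENNReal.ofReal_le_ofReal (Real.exp_le_exp.2 ?_)
        have : 0 ≤ t * x := mul_nonneg ht (le_of_lt hx)
        simp only [NNReal.coe_one, div_one]
        linarith [neg_sq t]
    _ = ENNReal.ofReal (Real.exp (-t ^ 2 / 2)) * gaussianReal 0 1 (Set.Ioi 0) := by
        rw [setLIntegral_const]
    _ ≤ ENNReal.ofReal (Real.exp (-t ^ 2 / 2)) * ENNReal.ofReal (1 / 2) := by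
        gcongr
        exact gaussianReal_Ioi_zero_le 1
    _ = ENNReal.ofReal (Real.exp (-t ^ 2 / 2) / 2) := by
        rw [← ENNReal.ofReal_mul (Real.exp_pos _).le]
        congr 1
        ring

lemma gaussianPDF_zero_one_le_one (x : ℝ) : gaussianPDF 0 1 x ≤ 1 := by
  rw [gaussianPDF, ENNReal.ofReal_le_one, gaussianPDFReal]
  have h1 : (√(2 * π * (1 : ℝ≥0)))⁻¹ ≤ 1 := by
    refine inv_le_one_of_one_le₀ (Real.one_le_sqrt.2 ?_)
    simp only [NNReal.coe_one]
    linarith [Real.pi_gt_three]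
  have h2 : Real.exp (-(x - 0) ^ 2 / (2 * (1 : ℝ≥0))) ≤ 1 := by
    rw [Real.exp_le_one_iff]
    simp only [NNReal.coe_one]
    linarith [sq_nonneg (x - 0)]
  exact mul_le_one₀ h1 (Real.exp_pos _).le h2

lemma gaussianReal_Ioi_le_of_nonpos {t : ℝ} (ht : t ≤ 0) :
    gaussianReal 0 1 (Set.Ioi t) ≤ ENNReal.ofReal (1 / 2 - t) := by
  have h : gaussianReal 0 1 (Set.Ioc t 0) ≤ ENNReal.ofReal (-t) := by
    rw [gaussianReal_apply _ one_ne_zero]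
    calc ∫⁻ x in Set.Ioc t 0, gaussianPDF 0 1 x ≤ ∫⁻ _ in Set.Ioc t 0, 1 :=
          lintegral_mono fun x => gaussianPDF_zero_one_le_one x
      _ = ENNReal.ofReal (-t) := by simp
  rw [← Set.Ioc_union_Ioi_eq_Ioi ht, show 1 / 2 - t = -t + 1 / 2 by ring,
    ENNReal.ofReal_add (by linarith) (by norm_num)]
  exact (measure_union_le _ _).trans (add_le_add h (gaussianReal_Ioi_zero_le 1))

/-- The Gaussian tail bound behind the calibration `c = √(2 ln(1.25/δ))`. -/
lemma gaussianReal_Ioi_le_of_calibrated {c ε δ t : ℝ} (hδ : 0 < δ) (hδ1 : δ < 1)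
    (hε1 : ε < 1) (hc : c = √(2 * Real.log (1.25 / δ)))
    (ht : c - ε / (2 * c) ≤ t) :
    gaussianReal 0 1 (Set.Ioi t) ≤ ENNReal.ofReal δ := by
  refine (measure_mono (Set.Ioi_subset_Ioi ht)).trans ?_
  set L := Real.log (1.25 / δ) with hL
  have hL0 : 0.2 ≤ L := by
    have h1 := Real.one_sub_inv_le_log_of_pos (x := 1.25 / δ) (by positivity)
    rw [inv_div] at h1
    have : δ / 1.25 ≤ 0.8 := by rw [div_le_iff₀ (by norm_num)]; linarith
    linarith
  have hc2 : c ^ 2 = 2 * L := by rw [hc, Real.sq_sqrt (by linarith)]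
  have hcpos : 0 < c := by rw [hc]; exact Real.sqrt_pos.2 (by linarith)
  have hδL : δ = 1.25 * Real.exp (-L) := by
    rw [Real.exp_neg, hL, Real.exp_log (by positivity)]
    field_simp
  rcases le_total 0 (c - ε / (2 * c)) with h0 | h0
  · refine (gaussianReal_Ioi_le_of_nonneg h0).trans (ENNReal.ofReal_le_ofReal ?_)
    have hsq : 2 * L - 1 ≤ (c - ε / (2 * c)) ^ 2 := by
      have : (c - ε / (2 * c)) ^ 2 = c ^ 2 - ε + (ε / (2 * c)) ^ 2 := by
        field_simp
        ring
      rw [this]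
      linarith [sq_nonneg (ε / (2 * c))]
    have h1 : Real.exp (-(c - ε / (2 * c)) ^ 2 / 2) ≤ Real.exp (-L) * Real.exp (1 / 2) := by
      rw [← Real.exp_add]
      exact Real.exp_le_exp.2 (by linarith)
    have h2 : Real.exp (1 / 2) ≤ 2.5 := by
      have := Real.exp_bound_div_one_sub_of_interval (x := 1 / 2) (by norm_num) (by norm_num)
      norm_num at this ⊢
      linarith
    have h3 := mul_le_mul_of_nonneg_left h2 (Real.exp_pos (-L)).le
    linarith
  · refine (gaussianReal_Ioi_le_of_nonpos h0).trans (ENNReal.ofReal_le_ofReal ?_)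
    have h1 : 2 * c ^ 2 ≤ ε := by
      have : c ≤ ε / (2 * c) := by linarith
      rw [le_div_iff₀ (by positivity)] at this
      linarith
    have hc5 : 0.5 ≤ c := by nlinarith
    have h2 : ε / (2 * c) - c ≤ 0.2 := by
      rw [sub_le_iff_le_add, div_le_iff₀ (by positivity)]
      nlinarith
    have h3 := Real.add_one_le_exp (-L)
    linarith

/-- A shifted isotropic Gaussian is dominated by `exp ε` times the centered one, up to the
probability that the privacy loss exceeds `ε`. -/
lemma pi_gaussianReal_map_add_apply_le {ι : Type*} [Fintype ι] (m : ι → ℝ) {v : ℝ≥0} {s W : ℝ}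
    (hs : 0 < s) (hsv : s ^ 2 = v) (hW : 0 < W) (hWm : W ^ 2 = ∑ i, m i ^ 2) (ε : ℝ)
    {T : Set (ι → ℝ)} (hT : MeasurableSet T) :
    (Measure.pi fun _ : ι => gaussianReal 0 v).map (fun x => x + m) T ≤
      ENNReal.ofReal (Real.exp ε) * (Measure.pi fun _ : ι => gaussianReal 0 v) T +
        gaussianReal 0 1 (Set.Ioi (ε / (W / s) - W / s / 2)) := by
  set P := Measure.pi fun _ : ι => gaussianReal 0 v with hP
  have hvpos : (0 : ℝ) < v := by rw [← hsv]; positivity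
  have hv : v ≠ 0 := by exact_mod_cast hvpos.ne'
  have hsum (x : ι → ℝ) : ∑ i, (m i * x i - m i ^ 2 / 2) = ∑ i, m i * x i - W ^ 2 / 2 := by
    rw [Finset.sum_sub_distrib, ← Finset.sum_div, hWm]
  set B : Set (ι → ℝ) := {x | ε < (∑ i, (m i * x i - m i ^ 2 / 2)) / v} with hB
  have hBm : MeasurableSet B := measurableSet_lt (by fun_prop) (by fun_prop)
  have hgood : P.map (fun x => x + m) (T \ B) ≤ ENNReal.ofReal (Real.exp ε) * P T := by
    rw [hP, pi_gaussianReal_map_add, pi_gaussianReal_eq_withDensity m hv,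
      withDensity_apply _ (hT.diff hBm), ← hP]
    calc _ ≤ ∫⁻ _ in T \ B, ENNReal.ofReal (Real.exp ε) ∂P :=
          setLIntegral_mono measurable_const fun x hx =>
            ENNReal.ofReal_le_ofReal (Real.exp_le_exp.2 (not_lt.1 hx.2))
      _ = ENNReal.ofReal (Real.exp ε) * P (T \ B) := setLIntegral_const _ _
      _ ≤ _ := by gcongr; exact Set.sdiff_subset
  have hbad : P.map (fun x => x + m) B = gaussianReal 0 1 (Set.Ioi (ε / (W / s) - W / s / 2)) := by
    rw [Measure.map_apply (by fun_prop) hBm,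
      ← pi_gaussianReal_map_sum_mul (fun i => m i / (s * W)) v 1,
      Measure.map_apply (by fun_prop) measurableSet_Ioi]
    · congr 1
      ext x
      have e1 : ∑ i, m i * (x + m) i - W ^ 2 / 2 = ∑ i, m i * x i + W ^ 2 / 2 := by
        simp only [Pi.add_apply, mul_add, Finset.sum_add_distrib]
        rw [hWm]
        simp only [pow_two]
        ring
      have e2 : ∑ i, m i / (s * W) * x i = (∑ i, m i * x i) / (s * W) := by
        rw [Finset.sum_div]
        exact Finset.sum_congr rfl fun i _ => by ring
      have e3 : ε / (W / s) - W / s / 2 = (ε * s ^ 2 - W ^ 2 / 2) / (s * W) := by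
        field_simp
      simp only [hB, Set.mem_preimage, Set.mem_ofPred_eq, Set.mem_Ioi]
      rw [hsum, e1, e2, e3, lt_div_iff₀ hvpos, ← hsv,
        div_lt_div_iff_of_pos_right (by positivity), sub_lt_iff_lt_add]
    · simp only [div_pow]
      rw [← Finset.sum_div, ← hWm, ← hsv, NNReal.coe_one]
      field_simp
  calc P.map (fun x => x + m) T ≤ P.map (fun x => x + m) (T \ B ∪ B) :=
        measure_mono (by simp)
    _ ≤ P.map (fun x => x + m) (T \ B) + P.map (fun x => x + m) B := measure_union_le _ _
    _ ≤ _ := by rw [hbad]; gcongr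

/-- The Gaussian mechanism `M(D) = f(D) + N(0, Δ²σ²I)` on a function `f` of L2-sensitivity
`Δ` is `(ε, δ)`-DP for `ε ∈ (0,1)` provided `σ ≥ √(2 ln(1.25/δ))/ε`. -/
theorem stmt4 {X : Type*} (d : ℕ) (adj : X → X → Prop)
    (f : X → EuclideanSpace ℝ (Fin d)) (Δ σ ε δ : ℝ)
    (hΔ : 0 < Δ) (hσpos : 0 < σ) (hδ : 0 < δ) (hδ1 : δ < 1)
    (hsens : ∀ D D', adj D D' → ‖f D - f D'‖ ≤ Δ)
    (hε0 : 0 < ε) (hε1 : ε < 1)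
    (hσ : Real.sqrt (2 * Real.log (1.25 / δ)) / ε ≤ σ) :
    IsDP (fun D => Measure.map
        (fun ξ => f D + (EuclideanSpace.equiv (Fin d) ℝ).symm ξ)
        (Measure.pi fun _ : Fin d => gaussianReal 0 ⟨(Δ * σ)^2, sq_nonneg _⟩))
      adj ε δ := by
  intro D D' hadj R hR
  set P := Measure.pi fun _ : Fin d => gaussianReal 0 ⟨(Δ * σ) ^ 2, sq_nonneg _⟩ with hP
  have hmeas (z : EuclideanSpace ℝ (Fin d)) :
      Measurable fun ξ : Fin d → ℝ => z + (EuclideanSpace.equiv (Fin d) ℝ).symm ξ :=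
    (continuous_const.add (EuclideanSpace.equiv (Fin d) ℝ).symm.continuous).measurable
  rcases eq_or_ne (f D) (f D') with hfD | hfD
  · simp only [hfD]
    refine le_add_right (le_mul_of_one_le_left zero_le ?_)
    exact ENNReal.one_le_ofReal.2 (Real.one_le_exp hε0.le)
  set w := f D - f D' with hw
  have hWpos : 0 < ‖w‖ := norm_pos_iff.2 (sub_ne_zero.2 hfD)
  set T : Set (Fin d → ℝ) :=
    (fun ξ => f D' + (EuclideanSpace.equiv (Fin d) ℝ).symm ξ) ⁻¹' R with hTdef
  have hT : MeasurableSet T := hmeas _ hR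
  have hshift : (P.map fun ξ => f D + (EuclideanSpace.equiv (Fin d) ℝ).symm ξ) R =
      P.map (fun ξ => ξ + EuclideanSpace.equiv (Fin d) ℝ w) T := by
    rw [Measure.map_apply (hmeas _) hR, Measure.map_apply (by fun_prop) hT]
    congr 1
    ext ξ
    simp only [hTdef, Set.mem_preimage, map_add, ContinuousLinearEquiv.symm_apply_apply]
    rw [show f D' + ((EuclideanSpace.equiv (Fin d) ℝ).symm ξ + w) =
      f D + (EuclideanSpace.equiv (Fin d) ℝ).symm ξ by rw [hw]; abel]
  change (P.map fun ξ => f D + (EuclideanSpace.equiv (Fin d) ℝ).symm ξ) R ≤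
    ENNReal.ofReal (Real.exp ε) *
      (P.map fun ξ => f D' + (EuclideanSpace.equiv (Fin d) ℝ).symm ξ) R + ENNReal.ofReal δ
  rw [hshift, Measure.map_apply (hmeas (f D')) hR]
  refine (pi_gaussianReal_map_add_apply_le (EuclideanSpace.equiv (Fin d) ℝ w)
    (v := ⟨(Δ * σ) ^ 2, sq_nonneg _⟩) (by positivity) rfl hWpos
    (EuclideanSpace.real_norm_sq_eq w) ε hT).trans ?_
  gcongr
  refine gaussianReal_Ioi_le_of_calibrated hδ hδ1 hε1 rfl ?_
  set c := √(2 * Real.log (1.25 / δ)) with hc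
  have hlog : 0 < Real.log (1.25 / δ) :=
    Real.log_pos (by rw [lt_div_iff₀ hδ]; linarith)
  have hcpos : 0 < c := Real.sqrt_pos.2 (by linarith)
  have hμ : ‖w‖ / (Δ * σ) ≤ ε / c := by
    rw [div_le_iff₀ hε0] at hσ
    rw [div_le_div_iff₀ (by positivity) hcpos]
    calc ‖w‖ * c ≤ Δ * (σ * ε) :=
          mul_le_mul (hsens D D' hadj) hσ hcpos.le hΔ.le
      _ = ε * (Δ * σ) := by ring
  have hμpos : 0 < ‖w‖ / (Δ * σ) := by positivity
  have h1 : c ≤ ε / (‖w‖ / (Δ * σ)) := by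
    rw [le_div_iff₀ hμpos]
    rw [le_div_iff₀ hcpos] at hμ
    linarith
  have h2 : ε / (2 * c) = ε / c / 2 := by field_simp
  rw [h2]
  linarith
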